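/- arXiv:2009.12685 — 2 statements merged into one kernel-verified Lean document; each statement's English description precedes it below -/
import Mathlib

section
/- Let A ⊆ ℝ^d be a finite set with at least two points. Then minwidth(A) ≤ PWidth(A) ≤ vf(conv(A)). -/
/-- The directional width of a finite set `A` with respect to a direction `r`. -/
noncomputable def dirW {d : ℕ} (A : Finset (EuclideanSpace ℝ (Fin d)))
    (r : EuclideanSpace ℝ (Fin d)) : ℝ :=
  sSup { p : ℝ | ∃ s ∈ A, ∃ v ∈ A, p = (inner ℝ (‖r‖⁻¹ • r) (s - v) : ℝ) }

/-- The width of a finite set `A`. -/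
noncomputable def width {d : ℕ} (A : Finset (EuclideanSpace ℝ (Fin d))) : ℝ :=
  sInf { w : ℝ | ∃ r : EuclideanSpace ℝ (Fin d), r ≠ 0 ∧
    r ∈ (affineSpan ℝ (A : Set (EuclideanSpace ℝ (Fin d)))).direction ∧ w = dirW A r }

/-- The minwidth of a finite set `A`. -/
noncomputable def minwidth {d : ℕ} (A : Finset (EuclideanSpace ℝ (Fin d))) : ℝ :=
  sInf { w : ℝ | ∃ B : Finset (EuclideanSpace ℝ (Fin d)), B ⊆ A ∧ 2 ≤ B.card ∧ w = width B }

/-- `x` is a proper convex combination of all elements of `T`. -/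
def ProperComb {d : ℕ} (T : Finset (EuclideanSpace ℝ (Fin d)))
    (x : EuclideanSpace ℝ (Fin d)) : Prop :=
  ∃ w : EuclideanSpace ℝ (Fin d) → ℝ,
    (∀ y ∈ T, 0 < w y) ∧ ∑ y ∈ T, w y = 1 ∧ ∑ y ∈ T, w y • y = x

/-- The pyramidal directional width. -/
noncomputable def PDirW {d : ℕ} (A : Finset (EuclideanSpace ℝ (Fin d)))
    (r x : EuclideanSpace ℝ (Fin d)) : ℝ :=
  sInf { w : ℝ | ∃ T : Finset (EuclideanSpace ℝ (Fin d)), T ⊆ A ∧ ProperComb T x ∧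
    w = sSup { p : ℝ | ∃ s ∈ A, ∃ v ∈ T, p = (inner ℝ (‖r‖⁻¹ • r) (s - v) : ℝ) } }

open Classical in
/-- The pyramidal width of a finite set `A`. -/
noncomputable def PWidth {d : ℕ} (A : Finset (EuclideanSpace ℝ (Fin d))) : ℝ :=
  sInf { w : ℝ | ∃ K : Set (EuclideanSpace ℝ (Fin d)),
    IsExtreme ℝ (convexHull ℝ (A : Set (EuclideanSpace ℝ (Fin d)))) K ∧ Convex ℝ K ∧
    K.Nonempty ∧ ∃ x ∈ K, ∃ r : EuclideanSpace ℝ (Fin d), r ≠ 0 ∧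
      (∃ c : ℝ, 0 ≤ c ∧ ∃ y ∈ K, r = c • (y - x)) ∧
      w = PDirW (A.filter (· ∈ K)) r x }

/-- `F` is a facet of the polytope `P`. -/
def IsFacetOf {d : ℕ} (P F : Set (EuclideanSpace ℝ (Fin d))) : Prop :=
  IsExposed ℝ P F ∧ F.Nonempty ∧
    Module.finrank ℝ (affineSpan ℝ F).direction + 1 =
      Module.finrank ℝ (affineSpan ℝ P).direction

/-- The vertex-facet distance of a polytope `P`. -/
noncomputable def vf {d : ℕ} (P : Set (EuclideanSpace ℝ (Fin d))) : ℝ :=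
  sInf { r : ℝ | ∃ F : Set (EuclideanSpace ℝ (Fin d)), IsFacetOf P F ∧
    r = sInf { s : ℝ | ∃ v ∈ Set.extremePoints ℝ P, v ∉ F ∧
      s = Metric.infDist v (affineSpan ℝ F : Set (EuclideanSpace ℝ (Fin d))) } }

open scoped Pointwise

section Farkas

variable {E ι : Type*} [NormedAddCommGroup E] [InnerProductSpace ℝ E]

/-- **Farkas' lemma** for finitely many vectors of a real inner product space. -/
theorem exists_nonneg_sum_smul_eq_of_inner_nonpos (s : Finset ι) (v : ι → E) (r : E)
    (h : ∀ x, (∀ i ∈ s, inner ℝ (v i) x ≤ 0) → inner ℝ r x ≤ 0) :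
    ∃ c : ι → ℝ, (∀ i ∈ s, 0 ≤ c i) ∧ r = ∑ i ∈ s, c i • v i := by
  classical
  induction s using Finset.induction_on generalizing v r with
  | empty =>
    refine ⟨0, by simp, ?_⟩
    have := h r (by simp)
    simpa using this
  | insert a s ha ih =>
    by_cases hs : ∀ x, (∀ i ∈ s, inner ℝ (v i) x ≤ 0) → inner ℝ r x ≤ 0
    · obtain ⟨c, hc, hr⟩ := ih v r hs
      refine ⟨fun i => if i = a then 0 else c i, ?_, ?_⟩
      · intro i hi
        by_cases hia : i = a
        · simp [hia]
        · simpa [hia] using hc i (Finset.mem_of_mem_insert_of_ne hi hia)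
      · rw [Finset.sum_insert ha, hr]
        simp only [if_true, zero_smul, zero_add]
        refine Finset.sum_congr rfl fun i hi => ?_
        rw [if_neg (ne_of_mem_of_not_mem hi ha)]
    · push Not at hs
      obtain ⟨x₁, hx₁, hrx₁⟩ := hs
      have hax₁ : 0 < inner ℝ (v a) x₁ := by
        by_contra hneg
        push Not at hneg
        refine absurd (h x₁ fun i hi => ?_) (not_le.2 hrx₁)
        rcases Finset.mem_insert.1 hi with rfl | hi
        exacts [hneg, hx₁ i hi]
      obtain ⟨x₀, hx₀, hrx₀, hax₀⟩ : ∃ x₀ : E, (∀ i ∈ s, inner ℝ (v i) x₀ ≤ 0) ∧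
          0 < inner ℝ r x₀ ∧ inner ℝ (v a) x₀ = 1 := by
        refine ⟨(inner ℝ (v a) x₁)⁻¹ • x₁, fun i hi => ?_, ?_, ?_⟩
        · rw [inner_smul_right]
          exact mul_nonpos_of_nonneg_of_nonpos (by positivity) (hx₁ i hi)
        · rw [inner_smul_right]
          positivity
        · rw [inner_smul_right, inv_mul_cancel₀ hax₁.ne']
      obtain ⟨c, hc, hr⟩ := ih (fun i => v i - (inner ℝ (v i) x₀ : ℝ) • v a)
        (r - (inner ℝ r x₀ : ℝ) • v a) (by
          intro x hx
          have key : ∀ y : E, inner ℝ (y - (inner ℝ y x₀ : ℝ) • v a) x =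
              inner ℝ y (x - (inner ℝ (v a) x : ℝ) • x₀) := by
            intro y
            rw [inner_sub_left, inner_sub_right, real_inner_smul_left, real_inner_smul_right,
              mul_comm]
          rw [key]
          refine h _ fun i hi => ?_
          rcases Finset.mem_insert.1 hi with rfl | hi
          · rw [inner_sub_right, real_inner_smul_right, hax₀]
            simp
          · rw [← key]
            exact hx i hi)
      refine ⟨fun i => if i = a then inner ℝ r x₀ - ∑ j ∈ s, c j * inner ℝ (v j) x₀ else c i,
        ?_, ?_⟩
      · intro i hi
        by_cases hia : i = a
        · have : ∑ j ∈ s, c j * inner ℝ (v j) x₀ ≤ 0 :=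
            Finset.sum_nonpos fun j hj =>
              mul_nonpos_of_nonneg_of_nonpos (hc j hj) (hx₀ j hj)
          simp only [hia, if_true]
          linarith
        · simpa [hia] using hc i (Finset.mem_of_mem_insert_of_ne hi hia)
      · have hsum : ∑ i ∈ s, (if i = a then inner ℝ r x₀ - ∑ j ∈ s, c j * inner ℝ (v j) x₀
            else c i) • v i = ∑ i ∈ s, c i • v i :=
          Finset.sum_congr rfl fun i hi => by rw [if_neg (ne_of_mem_of_not_mem hi ha)]
        rw [Finset.sum_insert ha, hsum]
        simp only [if_true]
        rw [sub_smul, Finset.sum_smul]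
        simp only [smul_sub, smul_smul, Finset.sum_sub_distrib] at hr
        rw [sub_eq_iff_eq_add] at hr
        refine hr.trans ?_
        abel

end Farkas

section ConvexHull

variable {E : Type*} [NormedAddCommGroup E] [InnerProductSpace ℝ E]

/-- A polytope containing a positive multiple of `r` has a furthest point in direction `r`, and
that point lies on a supporting hyperplane transversal to `r`. -/
theorem exists_pos_smul_mem_convexHull_and_support (Z : Finset E) {r : E} (hr : r ≠ 0) {t₀ : ℝ}
    (ht₀ : 0 < t₀) (hmem : t₀ • r ∈ convexHull ℝ (Z : Set E)) :
    ∃ t : ℝ, 0 < t ∧ t • r ∈ convexHull ℝ (Z : Set E) ∧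
      ∃ g : E, 0 < inner ℝ g r ∧ ∀ z ∈ Z, inner ℝ g z ≤ inner ℝ g (t • r) := by
  have hcomp : IsCompact ((fun t : ℝ => t • r) ⁻¹' convexHull ℝ (Z : Set E)) :=
    (isClosedEmbedding_smul_left hr).isCompact_preimage (Z.finite_toSet.isCompact_convexHull ℝ)
  obtain ⟨t, ht, hmax⟩ := hcomp.exists_isMaxOn ⟨t₀, hmem⟩ continuousOn_id
  have ht' : t • r ∈ convexHull ℝ (Z : Set E) := ht
  refine ⟨t, ht₀.trans_le (hmax hmem), ht', ?_⟩
  by_contra hcon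
  push Not at hcon
  obtain ⟨c, hc, hrc⟩ := exists_nonneg_sum_smul_eq_of_inner_nonpos Z (fun z => z - t • r) r (by
    intro g hg
    by_contra hpos
    push Not at hpos
    rw [real_inner_comm] at hpos
    obtain ⟨z, hz, hlt⟩ := hcon g hpos
    have := hg z hz
    rw [real_inner_comm, inner_sub_right] at this
    linarith)
  have hC : 0 < ∑ z ∈ Z, c z := by
    refine lt_of_le_of_ne (Finset.sum_nonneg hc) fun h0 => hr ?_
    rw [hrc]
    refine Finset.sum_eq_zero fun z hz => ?_
    rw [(Finset.sum_eq_zero_iff_of_nonneg hc).1 h0.symm z hz, zero_smul]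
  set C := ∑ z ∈ Z, c z with hCdef
  have hcm : Z.centerMass c id ∈ convexHull ℝ (Z : Set E) :=
    Finset.centerMass_mem_convexHull Z hc hC fun z hz => hz
  have hsum : C • Z.centerMass c id = r + (C * t) • r := by
    rw [Finset.centerMass, smul_smul, mul_inv_cancel₀ hC.ne', one_smul]
    simp only [smul_sub, Finset.sum_sub_distrib, ← Finset.sum_smul] at hrc
    rw [eq_sub_iff_add_eq] at hrc
    rw [← smul_smul]
    exact hrc.symm
  have hnew : (t + 1 / (1 + C)) • r ∈ convexHull ℝ (Z : Set E) := by
    have hcomb := convex_convexHull ℝ (Z : Set E) ht' hcm (a := 1 / (1 + C)) (b := C / (1 + C))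
      (by positivity) (by positivity) (by field_simp)
    have heq : (1 / (1 + C)) • t • r + (C / (1 + C)) • Z.centerMass c id =
        (t + 1 / (1 + C)) • r := by
      rw [div_eq_mul_inv C, mul_comm C, ← smul_smul _ C, hsum, smul_add, smul_smul, smul_smul,
        ← add_smul, ← add_smul]
      congr 1
      field_simp
      ring
    rwa [heq] at hcomb
  have : t + 1 / (1 + C) ≤ t := hmax hnew
  have : 0 < 1 / (1 + C) := by positivity
  linarith

/-- A point of a polytope at which a linear functional is maximal is a combination of the
generators at which it is maximal. -/
theorem mem_span_of_mem_convexHull_of_inner_eq (Z : Finset E) {g p : E}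
    (hp : p ∈ convexHull ℝ (Z : Set E)) (hg : ∀ z ∈ Z, inner ℝ g z ≤ inner ℝ g p) :
    p ∈ Submodule.span ℝ {z : E | z ∈ Z ∧ inner ℝ g z = inner ℝ g p} := by
  obtain ⟨w, hw, hw1, hwp⟩ := Finset.mem_convexHull'.1 hp
  have hzero : ∑ z ∈ Z, w z * (inner ℝ g p - inner ℝ g z) = 0 := by
    simp only [mul_sub, Finset.sum_sub_distrib, ← Finset.sum_mul, hw1, one_mul]
    conv_lhs => enter [1]; rw [← hwp, inner_sum]
    simp [inner_smul_right]
  rw [Finset.sum_eq_zero_iff_of_nonneg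
    (fun z hz => mul_nonneg (hw z hz) (sub_nonneg.2 (hg z hz)))] at hzero
  rw [← hwp]
  refine Submodule.sum_mem _ fun z hz => ?_
  rcases mul_eq_zero.1 (hzero z hz) with h | h
  · rw [h, zero_smul]
    exact Submodule.zero_mem _
  · refine Submodule.smul_mem _ _ (Submodule.subset_span ⟨hz, ?_⟩)
    rw [hwp]
    linarith

end ConvexHull

section Width

variable {d : ℕ}

theorem finite_setOf_inner_sub (A T : Finset (EuclideanSpace ℝ (Fin d)))
    (r : EuclideanSpace ℝ (Fin d)) :
    {p : ℝ | ∃ s ∈ A, ∃ v ∈ T, p = (inner ℝ r (s - v) : ℝ)}.Finite := by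
  refine ((A ×ˢ T).image fun q => (inner ℝ r (q.1 - q.2) : ℝ)).finite_toSet.subset ?_
  rintro p ⟨s, hs, v, hv, rfl⟩
  exact Finset.mem_coe.2 (Finset.mem_image.2 ⟨(s, v), Finset.mk_mem_product hs hv, rfl⟩)

theorem sSup_inner_sub_nonneg {A T : Finset (EuclideanSpace ℝ (Fin d))} (hT : T ⊆ A)
    (r : EuclideanSpace ℝ (Fin d)) :
    0 ≤ sSup {p : ℝ | ∃ s ∈ A, ∃ v ∈ T, p = (inner ℝ r (s - v) : ℝ)} := by
  rcases T.eq_empty_or_nonempty with rfl | ⟨v, hv⟩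
  · simp
  · exact le_csSup (finite_setOf_inner_sub A T r).bddAbove ⟨v, hT hv, v, hv, by simp⟩

theorem dirW_nonneg (A : Finset (EuclideanSpace ℝ (Fin d))) (r : EuclideanSpace ℝ (Fin d)) :
    0 ≤ dirW A r :=
  sSup_inner_sub_nonneg subset_rfl _

theorem width_nonneg (A : Finset (EuclideanSpace ℝ (Fin d))) : 0 ≤ width A := by
  refine Real.sInf_nonneg ?_
  rintro w ⟨r, -, -, rfl⟩
  exact dirW_nonneg A r

theorem width_le_dirW {A : Finset (EuclideanSpace ℝ (Fin d))} {r : EuclideanSpace ℝ (Fin d)}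
    (hr : r ≠ 0) (hmem : r ∈ (affineSpan ℝ (A : Set (EuclideanSpace ℝ (Fin d)))).direction) :
    width A ≤ dirW A r := by
  refine csInf_le ⟨0, ?_⟩ ⟨r, hr, hmem, rfl⟩
  rintro w ⟨r, -, -, rfl⟩
  exact dirW_nonneg A r

theorem minwidth_le_width {A B : Finset (EuclideanSpace ℝ (Fin d))} (hB : B ⊆ A)
    (hcard : 2 ≤ B.card) : minwidth A ≤ width B := by
  refine csInf_le ⟨0, ?_⟩ ⟨B, hB, hcard, rfl⟩
  rintro w ⟨B, -, -, rfl⟩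
  exact width_nonneg B

theorem PDirW_nonneg (A : Finset (EuclideanSpace ℝ (Fin d))) (r x : EuclideanSpace ℝ (Fin d)) :
    0 ≤ PDirW A r x := by
  refine Real.sInf_nonneg ?_
  rintro w ⟨T, hT, -, rfl⟩
  exact sSup_inner_sub_nonneg hT _

theorem dirW_le_of_inner_sub_le {B : Finset (EuclideanSpace ℝ (Fin d))}
    {g : EuclideanSpace ℝ (Fin d)} {c : ℝ} (hg : g ≠ 0) (hc : 0 ≤ c)
    (h : ∀ b ∈ B, ∀ b' ∈ B, inner ℝ g (b - b') ≤ c * ‖g‖) : dirW B g ≤ c := by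
  refine Real.sSup_le ?_ hc
  rintro p ⟨b, hb, b', hb', rfl⟩
  have hpos : 0 < ‖g‖ := norm_pos_iff.2 hg
  rw [real_inner_smul_left, inv_mul_le_iff₀ hpos, mul_comm]
  exact h b hb b' hb'

/-- If some positive multiple of `r` is a difference of a point of `conv A` and a point of
`conv S`, then some subset of `A` has width at most the largest variation of `r` between `S`
and `A`. -/
theorem exists_width_le_sSup_inner_sub {A S : Finset (EuclideanSpace ℝ (Fin d))} (hS : S ⊆ A)
    {r : EuclideanSpace ℝ (Fin d)} (hr : r ≠ 0) {t₀ : ℝ} (ht₀ : 0 < t₀)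
    (hmem : t₀ • r ∈ convexHull ℝ (A : Set (EuclideanSpace ℝ (Fin d))) -
      convexHull ℝ (S : Set (EuclideanSpace ℝ (Fin d)))) :
    ∃ B ⊆ A, 2 ≤ B.card ∧
      width B ≤ sSup {p : ℝ | ∃ s ∈ A, ∃ v ∈ S, p = (inner ℝ (‖r‖⁻¹ • r) (s - v) : ℝ)} := by
  classical
  rw [← convexHull_sub, ← Finset.coe_sub] at hmem
  obtain ⟨t, ht, htr, g, hgr, hg⟩ :=
    exists_pos_smul_mem_convexHull_and_support (A - S) hr ht₀ hmem
  have hspan := mem_span_of_mem_convexHull_of_inner_eq (A - S) htr hg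
  have hrpos : 0 < ‖r‖ := norm_pos_iff.2 hr
  have hle : t * ‖r‖ ≤
      sSup {p : ℝ | ∃ s ∈ A, ∃ v ∈ S, p = (inner ℝ (‖r‖⁻¹ • r) (s - v) : ℝ)} := by
    set c := sSup {p : ℝ | ∃ s ∈ A, ∃ v ∈ S, p = (inner ℝ (‖r‖⁻¹ • r) (s - v) : ℝ)} with hc
    have hsub : convexHull ℝ ((A - S : Finset _) : Set (EuclideanSpace ℝ (Fin d))) ⊆
        {z | inner ℝ (‖r‖⁻¹ • r) z ≤ c} := by
      refine convexHull_min ?_ (convex_halfSpace_le (innerSL ℝ (‖r‖⁻¹ • r)).isLinear c)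
      intro z hz
      obtain ⟨s, hs, v, hv, rfl⟩ := Finset.mem_sub.1 hz
      exact le_csSup (finite_setOf_inner_sub A S _).bddAbove ⟨s, hs, v, hv, rfl⟩
    have := hsub htr
    simp only [Set.mem_ofPred_eq, real_inner_smul_left, real_inner_smul_right,
      real_inner_self_eq_norm_sq] at this
    convert this using 1
    field_simp
  set μ : ℝ := inner ℝ g (t • r) with hμ
  have hμ0 : 0 ≤ μ := by
    rw [hμ, real_inner_smul_right]
    positivity
  have hg' : ∀ a ∈ A, ∀ s ∈ S, inner ℝ g a - inner ℝ g s ≤ μ := fun a ha s hs => by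
    rw [← inner_sub_right]
    exact hg _ (Finset.sub_mem_sub ha hs)
  set B : Finset (EuclideanSpace ℝ (Fin d)) :=
    A.filter (fun a => ∃ s ∈ S, inner ℝ g a - inner ℝ g s = μ) ∪
      S.filter (fun s => ∃ a ∈ A, inner ℝ g a - inner ℝ g s = μ) with hB
  have hBA : B ⊆ A :=
    Finset.union_subset (Finset.filter_subset _ _) ((Finset.filter_subset _ _).trans hS)
  have hdiff : ∀ b ∈ B, ∀ b' ∈ B, inner ℝ g (b - b') ≤ μ := by
    intro b hb b' hb'
    rw [inner_sub_right]
    simp only [hB, Finset.mem_union, Finset.mem_filter] at hb hb'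
    rcases hb with ⟨hb, s, hs, hbs⟩ | ⟨hb, s, hs, hbs⟩ <;>
      rcases hb' with ⟨hb', s', hs', hbs'⟩ | ⟨hb', s', hs', hbs'⟩
    · linarith [hg' b hb s' hs']
    · exact hg' b hb b' hb'
    · linarith [hg' s hs s' hs']
    · linarith [hg' s hs b' hb']
  set D := (affineSpan ℝ (B : Set (EuclideanSpace ℝ (Fin d)))).direction with hD
  have hsubD : ∀ b ∈ B, ∀ b' ∈ B, b - b' ∈ D := fun b hb b' hb' =>
    AffineSubspace.vsub_mem_direction (subset_affineSpan ℝ _ hb) (subset_affineSpan ℝ _ hb')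
  have hrD : r ∈ D := by
    have htrD : t • r ∈ D := by
      refine (Submodule.span_le.2 ?_) hspan
      rintro z ⟨hz, hzμ⟩
      obtain ⟨a, ha, s, hs, rfl⟩ := Finset.mem_sub.1 hz
      rw [inner_sub_right] at hzμ
      refine hsubD a ?_ s ?_
      · exact Finset.mem_union_left _ (Finset.mem_filter.2 ⟨ha, s, hs, hzμ⟩)
      · exact Finset.mem_union_right _ (Finset.mem_filter.2 ⟨hs, a, ha, hzμ⟩)
    simpa [smul_smul, inv_mul_cancel₀ ht.ne'] using D.smul_mem t⁻¹ htrD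
  have hcard : 2 ≤ B.card := by
    by_contra hlt
    have hsing : (B : Set (EuclideanSpace ℝ (Fin d))).Subsingleton := by
      have : B.card ≤ 1 := by omega
      intro x hx y hy
      exact Finset.card_le_one.1 this x hx y hy
    rw [hD, direction_affineSpan, vectorSpan_of_subsingleton ℝ hsing] at hrD
    exact hr (by simpa using hrD)
  set g' := D.starProjection g with hg'def
  have hproj : ∀ z ∈ D, inner ℝ g' z = inner ℝ g z := fun z hz => by
    have := Submodule.starProjection_inner_eq_zero (K := D) g z hz
    rw [inner_sub_left] at this
    linarith
  have hg'0 : g' ≠ 0 := by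
    intro h0
    have := hproj r hrD
    rw [h0, inner_zero_left] at this
    linarith
  refine ⟨B, hBA, hcard, (width_le_dirW hg'0 (Submodule.starProjection_apply_mem D g)).trans
    (le_trans (dirW_le_of_inner_sub_le hg'0 (by positivity) ?_) hle)⟩
  intro b hb b' hb'
  rw [hproj _ (hsubD b hb b' hb')]
  refine (hdiff b hb b' hb').trans ?_
  rw [hμ, real_inner_smul_right, ← hproj r hrD, mul_assoc]
  refine mul_le_mul_of_nonneg_left ?_ ht.le
  rw [mul_comm]
  exact real_inner_le_norm g' r

/-- A point of an extreme subset of a polytope is a proper convex combination of generators lying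
in that subset. -/
theorem exists_properComb_of_isExtreme {A : Finset (EuclideanSpace ℝ (Fin d))}
    {K : Set (EuclideanSpace ℝ (Fin d))}
    (hK : IsExtreme ℝ (convexHull ℝ (A : Set (EuclideanSpace ℝ (Fin d)))) K)
    {x : EuclideanSpace ℝ (Fin d)} (hx : x ∈ K) :
    ∃ T ⊆ A, (∀ a ∈ T, a ∈ K) ∧ ProperComb T x := by
  classical
  obtain ⟨w, hw, hw1, hwx⟩ := Finset.mem_convexHull'.1 (hK.subset hx)
  have hne : ∀ a ∈ A, a ∉ A.filter (fun a => 0 < w a) → w a = 0 := fun a ha hna =>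
    le_antisymm (not_lt.1 fun h => hna (Finset.mem_filter.2 ⟨ha, h⟩)) (hw a ha)
  refine ⟨A.filter fun a => 0 < w a, Finset.filter_subset _ _, ?_, w,
    fun a ha => (Finset.mem_filter.1 ha).2, ?_, ?_⟩
  · intro a ha
    obtain ⟨haA, hwa⟩ := Finset.mem_filter.1 ha
    have hsum1 : ∑ b ∈ A.erase a, w b = 1 - w a := by
      rw [← hw1, ← Finset.add_sum_erase A w haA]
      ring
    have hsumx : w a • a + ∑ b ∈ A.erase a, w b • b = x := by
      rw [← hwx]
      exact Finset.add_sum_erase A (fun b => w b • b) haA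
    have hnonneg : ∀ b ∈ A.erase a, 0 ≤ w b := fun b hb => hw b (Finset.mem_of_mem_erase hb)
    rcases (Finset.sum_nonneg hnonneg).eq_or_lt with h0 | hpos
    · have hz := (Finset.sum_eq_zero_iff_of_nonneg hnonneg).1 h0.symm
      rw [Finset.sum_eq_zero fun b hb => by rw [hz b hb, zero_smul],
        show w a = 1 by linarith, one_smul, add_zero] at hsumx
      rwa [hsumx]
    · have hz : (A.erase a).centerMass w id ∈
          convexHull ℝ (A : Set (EuclideanSpace ℝ (Fin d))) :=
        Finset.centerMass_mem_convexHull _ hnonneg hpos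
          fun b hb => Finset.mem_of_mem_erase hb
      refine hK.left_mem_of_mem_openSegment (subset_convexHull ℝ _ haA) hz hx
        ⟨w a, ∑ b ∈ A.erase a, w b, hwa, hpos, by linarith, ?_⟩
      rw [Finset.centerMass, smul_smul, mul_inv_cancel₀ hpos.ne', one_smul]
      exact hsumx
  · rw [← hw1]
    exact Finset.sum_subset (Finset.filter_subset _ _) hne
  · rw [← hwx]
    exact Finset.sum_subset (Finset.filter_subset _ _) fun a ha hna => by
      rw [hne a ha hna, zero_smul]

theorem ProperComb.mem_convexHull {T : Finset (EuclideanSpace ℝ (Fin d))}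
    {x : EuclideanSpace ℝ (Fin d)} (h : ProperComb T x) :
    x ∈ convexHull ℝ (T : Set (EuclideanSpace ℝ (Fin d))) := by
  obtain ⟨w, hw, hw1, hwx⟩ := h
  exact Finset.mem_convexHull'.2 ⟨w, fun y hy => (hw y hy).le, hw1, hwx⟩

theorem minwidth_le_PWidth {A : Finset (EuclideanSpace ℝ (Fin d))} (hcard : 2 ≤ A.card) :
    minwidth A ≤ PWidth A := by
  classical
  refine le_csInf ?_ ?_
  · obtain ⟨a, ha, b, hb, hab⟩ := Finset.one_lt_card.1 hcard
    exact ⟨_, _, IsExtreme.refl ℝ _, convex_convexHull ℝ _, ⟨a, subset_convexHull ℝ _ ha⟩, a,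
      subset_convexHull ℝ _ ha, b - a, sub_ne_zero.2 hab.symm,
      ⟨1, zero_le_one, b, subset_convexHull ℝ _ hb, (one_smul ℝ _).symm⟩, rfl⟩
  rintro _ ⟨K, hK, -, -, x, hx, r, hr, ⟨c, hc, y, hy, hrc⟩, rfl⟩
  have hc' : 0 < c := hc.lt_of_ne fun h => hr (by rw [hrc, ← h, zero_smul])
  refine le_csInf ?_ ?_
  · obtain ⟨T, hTA, hTK, hT⟩ := exists_properComb_of_isExtreme hK hx
    exact ⟨_, T, fun a ha => Finset.mem_filter.2 ⟨hTA ha, hTK a ha⟩, hT, rfl⟩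
  rintro _ ⟨S, hSA, hS, rfl⟩
  obtain ⟨T, hTA, hTK, hT⟩ := exists_properComb_of_isExtreme hK hy
  have hyA : y ∈ convexHull ℝ
      ((A.filter (· ∈ K) : Finset _) : Set (EuclideanSpace ℝ (Fin d))) :=
    convexHull_mono (fun a ha => Finset.mem_coe.2 (Finset.mem_filter.2 ⟨hTA ha, hTK a ha⟩))
      hT.mem_convexHull
  obtain ⟨B, hBA, hBcard, hB⟩ := exists_width_le_sSup_inner_sub hSA hr (inv_pos.2 hc')
    ⟨y, hyA, x, hS.mem_convexHull, by
      simp only [hrc, smul_smul, inv_mul_cancel₀ hc'.ne', one_smul]⟩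
  exact (minwidth_le_width (hBA.trans (Finset.filter_subset _ _)) hBcard).trans hB

end Width

section Facets

variable {d : ℕ}

open Classical in
theorem affineSpan_eq_of_isExtreme_convexHull {A : Finset (EuclideanSpace ℝ (Fin d))}
    {K : Set (EuclideanSpace ℝ (Fin d))}
    (hK : IsExtreme ℝ (convexHull ℝ (A : Set (EuclideanSpace ℝ (Fin d)))) K) :
    affineSpan ℝ K =
      affineSpan ℝ ((A.filter (· ∈ K) : Finset _) : Set (EuclideanSpace ℝ (Fin d))) := by
  refine le_antisymm (affineSpan_le.2 fun x hx => ?_)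
    (affineSpan_mono ℝ fun a ha => (Finset.mem_filter.1 (Finset.mem_coe.1 ha)).2)
  obtain ⟨T, hTA, hTK, hT⟩ := exists_properComb_of_isExtreme hK hx
  exact affineSpan_mono ℝ
    (fun a ha => Finset.mem_coe.2 (Finset.mem_filter.2 ⟨hTA ha, hTK a ha⟩))
    (convexHull_subset_affineSpan _ hT.mem_convexHull)

open Classical in
/-- The elements of a finite set at which the linear functional `⟨g, ·⟩` is maximal. -/
noncomputable def argmaxInner (A : Finset (EuclideanSpace ℝ (Fin d)))
    (g : EuclideanSpace ℝ (Fin d)) : Finset (EuclideanSpace ℝ (Fin d)) :=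
  A.filter fun a => ∀ b ∈ A, (inner ℝ g b : ℝ) ≤ inner ℝ g a

theorem mem_argmaxInner {A : Finset (EuclideanSpace ℝ (Fin d))}
    {g a : EuclideanSpace ℝ (Fin d)} :
    a ∈ argmaxInner A g ↔ a ∈ A ∧ ∀ b ∈ A, (inner ℝ g b : ℝ) ≤ inner ℝ g a := by
  classical
  simp [argmaxInner]

theorem argmaxInner_nonempty {A : Finset (EuclideanSpace ℝ (Fin d))} (hA : A.Nonempty)
    (g : EuclideanSpace ℝ (Fin d)) : (argmaxInner A g).Nonempty := by
  obtain ⟨a, ha, hmax⟩ := A.exists_max_image (fun a => (inner ℝ g a : ℝ)) hA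
  exact ⟨a, mem_argmaxInner.2 ⟨ha, hmax⟩⟩

theorem exists_inner_sub_ne_zero_of_mem_vectorSpan {A : Set (EuclideanSpace ℝ (Fin d))}
    {h a₀ : EuclideanSpace ℝ (Fin d)} (ha₀ : a₀ ∈ A) (hV : h ∈ vectorSpan ℝ A) (h0 : h ≠ 0) :
    ∃ a ∈ A, (inner ℝ h (a - a₀) : ℝ) ≠ 0 := by
  by_contra hcon
  push Not at hcon
  refine h0 (inner_self_eq_zero (𝕜 := ℝ).1 ?_)
  rw [vectorSpan_eq_span_vsub_set_right ℝ ha₀] at hV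
  have hle : Submodule.span ℝ ((· -ᵥ a₀) '' A) ≤ (ℝ ∙ h)ᗮ := by
    refine Submodule.span_le.2 ?_
    rintro _ ⟨a, ha, rfl⟩
    exact Submodule.mem_orthogonal_singleton_iff_inner_right.2 (hcon a ha)
  exact Submodule.mem_orthogonal_singleton_iff_inner_right.1 (hle hV)

/-- Rotating a functional towards a nonconstant one that is constant on its maximal face enlarges
the maximal face. -/
theorem exists_argmaxInner_ssubset {A : Finset (EuclideanSpace ℝ (Fin d))} (hA : A.Nonempty)
    {g h : EuclideanSpace ℝ (Fin d)}
    (hV : h ∈ vectorSpan ℝ (A : Set (EuclideanSpace ℝ (Fin d)))) (h0 : h ≠ 0)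
    (hconst : ∀ a ∈ argmaxInner A g, ∀ b ∈ argmaxInner A g, (inner ℝ h (a - b) : ℝ) = 0) :
    ∃ t : ℝ, argmaxInner A g ⊂ argmaxInner A (g + t • h) := by
  classical
  obtain ⟨a₀, ha₀⟩ := argmaxInner_nonempty hA g
  obtain ⟨ha₀A, hmax⟩ := mem_argmaxInner.1 ha₀
  obtain ⟨a₁, ha₁, hne⟩ := exists_inner_sub_ne_zero_of_mem_vectorSpan ha₀A hV h0
  wlog hpos : 0 < (inner ℝ h (a₁ - a₀) : ℝ) generalizing h
  · obtain ⟨t, ht⟩ := this (h := -h) (Submodule.neg_mem _ hV) (neg_ne_zero.2 h0)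
      (fun a ha b hb => by rw [inner_neg_left, hconst a ha b hb, neg_zero])
      (by rwa [inner_neg_left, neg_ne_zero])
      (by rw [inner_neg_left, neg_pos]; exact lt_of_le_of_ne (not_lt.1 hpos) hne)
    exact ⟨-t, by simpa using ht⟩
  obtain ⟨a, ha, hmin⟩ := (A.filter fun a => 0 < (inner ℝ h (a - a₀) : ℝ)).exists_min_image
    (fun a => (inner ℝ g (a₀ - a) : ℝ) / inner ℝ h (a - a₀))
    ⟨a₁, Finset.mem_filter.2 ⟨ha₁, hpos⟩⟩
  obtain ⟨haA, hapos⟩ := Finset.mem_filter.1 ha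
  set t : ℝ := (inner ℝ g (a₀ - a) : ℝ) / inner ℝ h (a - a₀) with ht
  have hslack : ∀ b ∈ A, 0 ≤ (inner ℝ g (a₀ - b) : ℝ) := fun b hb => by
    rw [inner_sub_right]
    exact sub_nonneg.2 (hmax b hb)
  have ht0 : 0 ≤ t := div_nonneg (hslack a haA) hapos.le
  have hval : ∀ b, (inner ℝ (g + t • h) b : ℝ) = inner ℝ (g + t • h) a₀ -
      inner ℝ g (a₀ - b) + t * inner ℝ h (b - a₀) := fun b => by
    simp only [inner_add_left, real_inner_smul_left, inner_sub_right]
    ring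
  have hle : ∀ b ∈ A, (inner ℝ (g + t • h) b : ℝ) ≤ inner ℝ (g + t • h) a₀ := by
    intro b hb
    rw [hval b]
    rcases le_or_gt (inner ℝ h (b - a₀) : ℝ) 0 with hb0 | hb0
    · linarith [hslack b hb, mul_nonpos_of_nonneg_of_nonpos ht0 hb0]
    · have := hmin b (Finset.mem_filter.2 ⟨hb, hb0⟩)
      rw [le_div_iff₀ hb0] at this
      linarith
  have hmem : ∀ b ∈ A, (inner ℝ (g + t • h) b : ℝ) = inner ℝ (g + t • h) a₀ →
      b ∈ argmaxInner A (g + t • h) := fun b hb heq =>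
    mem_argmaxInner.2 ⟨hb, fun c hc => heq ▸ hle c hc⟩
  refine ⟨t, Finset.ssubset_iff_subset_ne.2 ⟨fun b hb => ?_, fun heq => ?_⟩⟩
  · obtain ⟨hbA, hbmax⟩ := mem_argmaxInner.1 hb
    refine hmem b hbA ?_
    have hgb : (inner ℝ g (a₀ - b) : ℝ) = 0 := by
      rw [inner_sub_right]
      linarith [hbmax a₀ ha₀A, hmax b hbA]
    rw [hval b, hgb, hconst b hb a₀ ha₀]
    ring
  · have haN : a ∈ argmaxInner A (g + t • h) := by
      refine hmem a haA ?_
      rw [hval a, ht, div_mul_cancel₀ _ hapos.ne']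
      ring
    rw [← heq] at haN
    exact hapos.ne' (hconst a haN a₀ ha₀)

theorem exists_maximal_argmaxInner {A : Finset (EuclideanSpace ℝ (Fin d))}
    (hcard : 2 ≤ A.card) :
    ∃ g ∈ vectorSpan ℝ (A : Set (EuclideanSpace ℝ (Fin d))), g ≠ 0 ∧
      ∀ h ∈ vectorSpan ℝ (A : Set (EuclideanSpace ℝ (Fin d))), h ≠ 0 →
        ¬ argmaxInner A g ⊂ argmaxInner A h := by
  obtain ⟨a, ha, b, hb, hab⟩ := Finset.one_lt_card.1 hcard
  obtain ⟨g, ⟨hgV, hg0⟩, hmin⟩ := (measure fun g => A.card - (argmaxInner A g).card).wf.has_min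
    {g | g ∈ vectorSpan ℝ (A : Set (EuclideanSpace ℝ (Fin d))) ∧ g ≠ 0}
    ⟨a - b, vsub_mem_vectorSpan ℝ ha hb, sub_ne_zero.2 hab⟩
  refine ⟨g, hgV, hg0, fun h hhV hh0 hlt => hmin h ⟨hhV, hh0⟩ ?_⟩
  have hcardlt := Finset.card_lt_card hlt
  have hle : (argmaxInner A h).card ≤ A.card :=
    Finset.card_le_card fun x hx => (mem_argmaxInner.1 hx).1
  change A.card - (argmaxInner A h).card < A.card - (argmaxInner A g).card
  omega

/-- A polytope with at least two points has a facet. -/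
theorem exists_isFacetOf_convexHull {A : Finset (EuclideanSpace ℝ (Fin d))}
    (hcard : 2 ≤ A.card) :
    ∃ F, IsFacetOf (convexHull ℝ (A : Set (EuclideanSpace ℝ (Fin d)))) F := by
  classical
  have hA : A.Nonempty := Finset.card_pos.1 (by omega)
  obtain ⟨g, hgV, hg0, hmax⟩ := exists_maximal_argmaxInner hcard
  set P := convexHull ℝ (A : Set (EuclideanSpace ℝ (Fin d))) with hP
  set V := vectorSpan ℝ (A : Set (EuclideanSpace ℝ (Fin d))) with hV
  set W := vectorSpan ℝ (argmaxInner A g : Set (EuclideanSpace ℝ (Fin d))) with hW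
  have hexp : IsExposed ℝ P ((innerSL ℝ g).toExposed P) :=
    ContinuousLinearMap.toExposed.isExposed
  have hfilter : A.filter (· ∈ (innerSL ℝ g).toExposed P) = argmaxInner A g := by
    ext a
    rw [Finset.mem_filter, mem_argmaxInner]
    refine and_congr_right fun ha => ⟨fun h b hb => h.2 b (subset_convexHull ℝ _ hb),
      fun h => ⟨subset_convexHull ℝ _ ha, fun y hy => ?_⟩⟩
    exact convexHull_min (t := {y | innerSL ℝ g y ≤ innerSL ℝ g a}) (fun b hb => h b hb)
      (convex_halfSpace_le (innerSL ℝ g).isLinear _) hy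
  have hWV : W ≤ V := vectorSpan_mono ℝ fun x hx => (mem_argmaxInner.1 hx).1
  have horth : ∀ z, z ∈ Wᗮ ↔ ∀ a ∈ argmaxInner A g, ∀ b ∈ argmaxInner A g,
      (inner ℝ z (a - b) : ℝ) = 0 := by
    intro z
    rw [Submodule.mem_orthogonal']
    refine ⟨fun h a ha b hb => h _ (vsub_mem_vectorSpan ℝ ha hb), fun h => ?_⟩
    have hle : W ≤ (ℝ ∙ z)ᗮ := by
      refine Submodule.span_le.2 ?_
      rintro _ ⟨a, ha, b, hb, rfl⟩
      exact Submodule.mem_orthogonal_singleton_iff_inner_right.2 (h a ha b hb)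
    exact fun u hu => Submodule.mem_orthogonal_singleton_iff_inner_right.1 (hle hu)
  have hgN : g ∈ Wᗮ ⊓ V := by
    refine ⟨(horth g).2 fun a ha b hb => ?_, hgV⟩
    rw [mem_argmaxInner] at ha hb
    rw [inner_sub_right]
    linarith [ha.2 b hb.1, hb.2 a ha.1]
  have hone : Module.finrank ℝ (Wᗮ ⊓ V : Submodule ℝ (EuclideanSpace ℝ (Fin d))) = 1 := by
    refine (finrank_eq_one_iff_of_nonzero' (⟨g, hgN⟩ : (Wᗮ ⊓ V : Submodule ℝ _))
      (fun h0 => hg0 (congrArg Subtype.val h0))).2 ?_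
    rintro ⟨h, hhW, hhV⟩
    by_contra hcon
    have hspan : ∀ c : ℝ, c • g ≠ h := fun c hc => hcon ⟨c, Subtype.ext hc⟩
    obtain ⟨t, ht⟩ := exists_argmaxInner_ssubset (g := g) hA hhV
      (fun h0 => hspan 0 (by rw [zero_smul, h0])) ((horth h).1 hhW)
    refine hmax _ (V.add_mem hgV (V.smul_mem t hhV)) (fun h0 => ?_) ht
    have ht0 : t ≠ 0 := by
      rintro rfl
      exact hg0 (by simpa using h0)
    refine hspan (-t⁻¹) ?_
    rw [eq_neg_of_add_eq_zero_left h0, smul_neg, neg_smul, neg_neg, smul_smul,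
      inv_mul_cancel₀ ht0, one_smul]
  refine ⟨_, hexp, ?_, ?_⟩
  · obtain ⟨a, ha⟩ := argmaxInner_nonempty hA g
    rw [← hfilter] at ha
    exact ⟨a, (Finset.mem_filter.1 ha).2⟩
  · rw [affineSpan_eq_of_isExtreme_convexHull hexp.isExtreme, hfilter, hP, affineSpan_convexHull,
      direction_affineSpan, direction_affineSpan, ← Submodule.finrank_add_inf_finrank_orthogonal hWV,
      hone]

/-- Every facet of a polytope misses some vertex. -/
theorem IsFacetOf.exists_extremePoint_notMem {A : Finset (EuclideanSpace ℝ (Fin d))}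
    {F : Set (EuclideanSpace ℝ (Fin d))}
    (hF : IsFacetOf (convexHull ℝ (A : Set (EuclideanSpace ℝ (Fin d)))) F) :
    ∃ v ∈ Set.extremePoints ℝ (convexHull ℝ (A : Set (EuclideanSpace ℝ (Fin d)))), v ∉ F := by
  obtain ⟨hexp, -, hdim⟩ := hF
  by_contra hcon
  push Not at hcon
  have hcomp := A.finite_toSet.isCompact_convexHull ℝ
  have hconv := convex_convexHull ℝ (A : Set (EuclideanSpace ℝ (Fin d)))
  have hsub : convexHull ℝ (A : Set (EuclideanSpace ℝ (Fin d))) ⊆ F := by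
    rw [← closure_convexHull_extremePoints hcomp hconv]
    exact closure_minimal (convexHull_min hcon (hexp.convex hconv)) (hexp.isClosed hcomp.isClosed)
  rw [hexp.subset.antisymm hsub] at hdim
  omega

theorem exists_sum_smul_eq_of_mem_affineSpan {G : Finset (EuclideanSpace ℝ (Fin d))}
    {p : EuclideanSpace ℝ (Fin d)}
    (hp : p ∈ affineSpan ℝ (G : Set (EuclideanSpace ℝ (Fin d)))) :
    ∃ w : EuclideanSpace ℝ (Fin d) → ℝ, ∑ y ∈ G, w y = 1 ∧ ∑ y ∈ G, w y • y = p := by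
  classical
  have hrange : (G : Set (EuclideanSpace ℝ (Fin d))) =
      Set.range (Subtype.val : G → EuclideanSpace ℝ (Fin d)) := by simp
  rw [hrange] at hp
  obtain ⟨w, hw, rfl⟩ := eq_affineCombination_of_mem_affineSpan_of_fintype hp
  refine ⟨fun y => if h : y ∈ G then w ⟨y, h⟩ else 0, ?_, ?_⟩
  · rw [← hw, ← Finset.sum_coe_sort]
    simp
  · rw [Finset.affineCombination_eq_linear_combination _ _ _ hw, ← Finset.sum_coe_sort]
    simp

open Classical in
/-- From a point close to the barycenter of `G` one can move inside `conv (insert v G)` in the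
direction from `v` to any point of the affine span of `G`, and land in `conv G`. -/
theorem exists_properComb_insert_add_smul_mem {G : Finset (EuclideanSpace ℝ (Fin d))}
    {v p : EuclideanSpace ℝ (Fin d)} (hvG : v ∉ G)
    (hp : p ∈ affineSpan ℝ (G : Set (EuclideanSpace ℝ (Fin d)))) :
    ∃ (x : EuclideanSpace ℝ (Fin d)) (ε : ℝ), 0 < ε ∧ ProperComb (insert v G) x ∧
      x + ε • (p - v) ∈ convexHull ℝ (G : Set (EuclideanSpace ℝ (Fin d))) := by
  obtain ⟨μ, hμ1, hμp⟩ := exists_sum_smul_eq_of_mem_affineSpan hp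
  have hGne : G.Nonempty := by
    rw [Finset.nonempty_iff_ne_empty]
    intro h
    simp [h] at hμ1
  have hk : (1 : ℝ) ≤ G.card := by exact_mod_cast hGne.card_pos
  set k : ℝ := (G.card : ℝ) with hkdef
  set M : ℝ := ∑ y ∈ G, |μ y| with hM
  have hM0 : 0 ≤ M := Finset.sum_nonneg fun y _ => abs_nonneg _
  have hμM : ∀ y ∈ G, -M ≤ μ y := fun y hy => by
    have h₁ := Finset.single_le_sum (f := fun y => |μ y|) (fun y _ => abs_nonneg _) hy
    have h₂ := neg_abs_le (μ y)
    linarith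
  set ε : ℝ := 1 / (1 + k * (1 + M)) with hε
  have hden : 0 < 1 + k * (1 + M) := by positivity
  have hε0 : 0 < ε := by positivity
  have hεeq : ε * (1 + k * (1 + M)) = 1 := by
    rw [hε]
    field_simp
  have hε1 : ε < 1 := by
    have : 0 < ε * (k * (1 + M)) := by positivity
    linarith
  have hksum : ∀ c : ℝ, ∑ _y ∈ G, c / k = c := fun c => by
    rw [Finset.sum_const, nsmul_eq_mul, ← hkdef]
    field_simp
  set x := ε • v + ∑ y ∈ G, ((1 - ε) / k) • y with hx
  refine ⟨x, ε, hε0, ?_, ?_⟩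
  · have hif : ∀ y ∈ G, (if y = v then ε else (1 - ε) / k) = (1 - ε) / k := fun y hy =>
      if_neg (ne_of_mem_of_not_mem hy hvG)
    refine ⟨fun y => if y = v then ε else (1 - ε) / k, fun y _ => ?_, ?_, ?_⟩
    · have : 0 < (1 - ε) / k := div_pos (by linarith) (by linarith)
      dsimp only
      split_ifs <;> assumption
    · rw [Finset.sum_insert hvG, Finset.sum_congr rfl hif, hksum]
      simp
    · rw [Finset.sum_insert hvG, hx]
      beta_reduce
      rw [if_pos rfl]
      exact congrArg _ (Finset.sum_congr rfl fun y hy => congrArg (· • y) (hif y hy))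
  · have hy' : x + ε • (p - v) = ∑ y ∈ G, ((1 - ε) / k + ε * μ y) • y := by
      simp only [add_smul, Finset.sum_add_distrib, ← smul_smul]
      rw [← Finset.smul_sum (f := fun y => μ y • y), hμp, hx, smul_sub]
      abel
    rw [hy']
    refine Finset.mem_convexHull'.2 ⟨fun y => (1 - ε) / k + ε * μ y, fun y hy => ?_, ?_, rfl⟩
    · have h₁ : (1 - ε) / k = ε * (1 + M) := by
        rw [div_eq_iff (by positivity)]
        linarith
      dsimp only
      rw [h₁, ← mul_add]
      have := hμM y hy
      exact mul_nonneg hε0.le (by linarith)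
    · rw [Finset.sum_add_distrib, hksum, ← Finset.mul_sum, hμ1]
      ring

/-- The orthogonal projection `p` of a point of a polytope to a facet not containing it: the
facet's hyperplane through `p` with normal `p - v` supports the polytope. -/
theorem IsFacetOf.exists_supporting_normal {A : Finset (EuclideanSpace ℝ (Fin d))}
    {F : Set (EuclideanSpace ℝ (Fin d))}
    (hF : IsFacetOf (convexHull ℝ (A : Set (EuclideanSpace ℝ (Fin d)))) F)
    {v : EuclideanSpace ℝ (Fin d)} (hvA : v ∈ A) (hvF : v ∉ F) :
    ∃ p ∈ affineSpan ℝ F,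
      ‖p - v‖ = Metric.infDist v (affineSpan ℝ F : Set (EuclideanSpace ℝ (Fin d))) ∧
      p - v ≠ 0 ∧ (∀ z ∈ (affineSpan ℝ F).direction, (inner ℝ (p - v) z : ℝ) = 0) ∧
      ∀ a ∈ A, (inner ℝ (p - v) (a - p) : ℝ) ≤ 0 := by
  obtain ⟨hexp, hne, hdim⟩ := hF
  obtain ⟨l, hl⟩ := hexp hne
  set P := convexHull ℝ (A : Set (EuclideanSpace ℝ (Fin d))) with hP
  have hAP : ∀ a ∈ A, a ∈ P := fun a ha => subset_convexHull ℝ _ ha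
  have : Nonempty (affineSpan ℝ F) := ((affineSpan_nonempty ℝ).2 hne).to_subtype
  obtain ⟨f₀, hf₀⟩ := hne
  have hf₀max : ∀ y ∈ P, l y ≤ l f₀ := by
    rw [hl] at hf₀
    exact hf₀.2
  have hlF : ∀ f ∈ F, l f = l f₀ := fun f hf => by
    have hf' := hf
    rw [hl] at hf'
    exact le_antisymm (hf₀max f hf'.1) (hf'.2 f₀ (hexp.subset hf₀))
  have hlW : ∀ z ∈ (affineSpan ℝ F).direction, l z = 0 := by
    intro z hz
    rw [direction_affineSpan] at hz
    have hle : vectorSpan ℝ F ≤ LinearMap.ker (l : EuclideanSpace ℝ (Fin d) →ₗ[ℝ] ℝ) := by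
      refine Submodule.span_le.2 ?_
      rintro _ ⟨a, ha, b, hb, rfl⟩
      simp [hlF a ha, hlF b hb]
    exact hle hz
  have hf₀S : f₀ ∈ affineSpan ℝ F := subset_affineSpan ℝ F hf₀
  set p : EuclideanSpace ℝ (Fin d) :=
    (EuclideanGeometry.orthogonalProjection (affineSpan ℝ F) v : EuclideanSpace ℝ (Fin d)) with hp
  have hpS : p ∈ affineSpan ℝ F := EuclideanGeometry.orthogonalProjection_mem v
  have hlp : l p = l f₀ := by
    have := hlW _ (AffineSubspace.vsub_mem_direction hpS hf₀S)
    rw [vsub_eq_sub, map_sub] at this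
    linarith
  have hlv : l v < l f₀ := by
    refine lt_of_le_of_ne (hf₀max v (hAP v hvA)) fun h => hvF ?_
    rw [hl]
    exact ⟨hAP v hvA, fun y hy => (hf₀max y hy).trans h.ge⟩
  set n := p - v with hn
  have hln : 0 < l n := by
    rw [hn, map_sub]
    linarith
  have hn0 : n ≠ 0 := fun h => by simp [h] at hln
  have hnW : ∀ z ∈ (affineSpan ℝ F).direction, (inner ℝ n z : ℝ) = 0 := fun z hz =>
    (Submodule.mem_orthogonal' _ _).1
      (EuclideanGeometry.orthogonalProjection_vsub_mem_direction_orthogonal (affineSpan ℝ F) v) z hz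
  have hFP : affineSpan ℝ F ≤ affineSpan ℝ P := affineSpan_mono ℝ hexp.subset
  have hdecomp : (affineSpan ℝ F).direction ⊔ (ℝ ∙ n) = (affineSpan ℝ P).direction := by
    refine Submodule.eq_of_le_of_finrank_le (sup_le (AffineSubspace.direction_le hFP) ?_) ?_
    · rw [Submodule.span_singleton_le_iff_mem]
      exact AffineSubspace.vsub_mem_direction (hFP hpS) (subset_affineSpan ℝ P (hAP v hvA))
    · have hlt : (affineSpan ℝ F).direction < (affineSpan ℝ F).direction ⊔ (ℝ ∙ n) := by
        refine lt_of_le_of_ne le_sup_left fun h => hln.ne' (hlW n ?_)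
        rw [h]
        exact Submodule.mem_sup_right (Submodule.mem_span_singleton_self n)
      have := Submodule.finrank_lt_finrank_of_lt hlt
      omega
  refine ⟨p, hpS, ?_, hn0, hnW, ?_⟩
  · rw [← dist_eq_norm, dist_comm, hp]
    exact EuclideanGeometry.dist_orthogonalProjection_eq_infDist _ v
  · intro a ha
    have hmem : a - p ∈ (affineSpan ℝ P).direction :=
      AffineSubspace.vsub_mem_direction (subset_affineSpan ℝ P (hAP a ha)) (hFP hpS)
    rw [← hdecomp] at hmem
    obtain ⟨z, hz, _, hcn, hsum⟩ := Submodule.mem_sup.1 hmem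
    obtain ⟨c, rfl⟩ := Submodule.mem_span_singleton.1 hcn
    have hla : c * l n = l a - l p := by
      rw [← map_sub, ← hsum, map_add, hlW z hz, map_smul, smul_eq_mul, zero_add]
    have hc : c ≤ 0 := by
      by_contra hc
      have := mul_pos (not_le.1 hc) hln
      linarith [hf₀max a (hAP a ha)]
    rw [← hsum, inner_add_right, hnW z hz, real_inner_smul_right, zero_add]
    exact mul_nonpos_of_nonpos_of_nonneg hc real_inner_self_nonneg

theorem PWidth_le_infDist_of_isFacetOf {A : Finset (EuclideanSpace ℝ (Fin d))}
    {F : Set (EuclideanSpace ℝ (Fin d))}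
    (hF : IsFacetOf (convexHull ℝ (A : Set (EuclideanSpace ℝ (Fin d)))) F)
    {v : EuclideanSpace ℝ (Fin d)} (hvA : v ∈ A) (hvF : v ∉ F) :
    PWidth A ≤ Metric.infDist v (affineSpan ℝ F : Set (EuclideanSpace ℝ (Fin d))) := by
  classical
  obtain ⟨p, hpS, hdist, hn0, hnW, hside⟩ := hF.exists_supporting_normal hvA hvF
  have hspan := affineSpan_eq_of_isExtreme_convexHull hF.1.isExtreme
  set P := convexHull ℝ (A : Set (EuclideanSpace ℝ (Fin d))) with hP
  set G := A.filter (· ∈ F) with hG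
  have hvG : v ∉ G := fun h => hvF (Finset.mem_filter.1 h).2
  have hTA : insert v G ⊆ A := Finset.insert_subset hvA (Finset.filter_subset _ _)
  obtain ⟨x, ε, hε0, hcomb, hy'⟩ := exists_properComb_insert_add_smul_mem hvG (hspan ▸ hpS)
  set n := p - v with hn
  have hnpos : 0 < ‖n‖ := norm_pos_iff.2 hn0
  have hy : x + ε • n ∈ P :=
    convexHull_mono (Finset.coe_subset.2 (Finset.filter_subset (· ∈ F) A)) hy'
  have hxP : x ∈ P := convexHull_mono (Finset.coe_subset.2 hTA) hcomb.mem_convexHull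
  have hfil : A.filter (· ∈ P) = A :=
    Finset.filter_true_of_mem fun a ha => subset_convexHull ℝ _ ha
  have hPW : PWidth A ≤ PDirW A n x := by
    refine csInf_le ⟨0, ?_⟩ ⟨P, IsExtreme.refl ℝ _, convex_convexHull ℝ _, ⟨x, hxP⟩, x, hxP, n,
      hn0, ⟨ε⁻¹, by positivity, x + ε • n, hy, ?_⟩, ?_⟩
    · rintro _ ⟨K, -, -, -, x, -, r, -, -, rfl⟩
      exact PDirW_nonneg _ _ _
    · rw [add_sub_cancel_left, smul_smul, inv_mul_cancel₀ hε0.ne', one_smul]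
    · convert rfl
  refine hPW.trans (le_trans (csInf_le ⟨0, ?_⟩ ⟨insert v G, hTA, hcomb, rfl⟩) ?_)
  · rintro _ ⟨T, hT, -, rfl⟩
    exact sSup_inner_sub_nonneg hT _
  rw [← hdist]
  refine Real.sSup_le ?_ hnpos.le
  rintro _ ⟨s, hs, u, hu, rfl⟩
  rw [real_inner_smul_left, inv_mul_le_iff₀ hnpos, ← real_inner_self_eq_norm_mul_norm,
    ← sub_add_sub_cancel s p u, inner_add_right]
  have hs' := hside s hs
  rcases Finset.mem_insert.1 hu with rfl | hu
  · linarith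
  · have hu' : u ∈ affineSpan ℝ F := subset_affineSpan ℝ F (Finset.mem_filter.1 hu).2
    have h0 := hnW _ (AffineSubspace.vsub_mem_direction hpS hu')
    rw [vsub_eq_sub] at h0
    linarith [real_inner_self_nonneg (x := n)]

theorem PWidth_le_vf {A : Finset (EuclideanSpace ℝ (Fin d))} (hcard : 2 ≤ A.card) :
    PWidth A ≤ vf (convexHull ℝ (A : Set (EuclideanSpace ℝ (Fin d)))) := by
  obtain ⟨F, hF⟩ := exists_isFacetOf_convexHull hcard
  refine le_csInf ⟨_, F, hF, rfl⟩ ?_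
  rintro _ ⟨F, hF, rfl⟩
  obtain ⟨v, hv, hvF⟩ := hF.exists_extremePoint_notMem
  refine le_csInf ⟨_, v, hv, hvF, rfl⟩ ?_
  rintro _ ⟨v, hv, hvF, rfl⟩
  exact PWidth_le_infDist_of_isFacetOf hF (extremePoints_convexHull_subset hv) hvF

end Facets

/-- Theorem (summary): for a finite set `A ⊆ ℝ^d` with at least two points,
`minwidth A ≤ PWidth A ≤ vf (conv A)`. -/
theorem stmt6 (d : ℕ) (A : Finset (EuclideanSpace ℝ (Fin d))) (hcard : 2 ≤ A.card) :
    minwidth A ≤ PWidth A ∧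
      PWidth A ≤ vf (convexHull ℝ (A : Set (EuclideanSpace ℝ (Fin d)))) :=
  ⟨minwidth_le_PWidth hcard, PWidth_le_vf hcard⟩
end

section
/- Let u, v ∈ ℝ^d be unit vectors, let ε > 0, and let c_S, c_T ∈ ℝ. Define the slabs B_S = { x ∈ ℝ^d : c_S ≤ ⟨x,u⟩ ≤ c_S + ε } and B_T = { x ∈ ℝ^d : c_T ≤ ⟨x,v⟩ ≤ c_T + ε }. Then the standard Gaussian measure of their intersection satisfies 𝒢(B_S ∩ B_T) ≤ ε² / √( 2π·(1 − ⟨u,v⟩²) ). -/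
open MeasureTheory ProbabilityTheory

/-- The standard Gaussian probability measure on `ℝ^d`. -/
noncomputable def stdGaussian (d : ℕ) : Measure (EuclideanSpace ℝ (Fin d)) :=
  (Measure.pi fun _ : Fin d => gaussianReal 0 1).map
    (MeasurableEquiv.toLp 2 (Fin d → ℝ))

lemma stdGaussian_eq_probabilityTheory_stdGaussian (d : ℕ) :
    _root_.stdGaussian d = ProbabilityTheory.stdGaussian (EuclideanSpace ℝ (Fin d)) :=
  map_pi_eq_stdGaussian

/-- The density of the standard Gaussian on `ℝ` is bounded by `1 / √(2π)`. -/
lemma gaussianReal_zero_one_le (s : Set ℝ) :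
    gaussianReal 0 1 s ≤ ENNReal.ofReal (√(2 * Real.pi))⁻¹ * volume s := by
  rw [gaussianReal_apply 0 one_ne_zero]
  calc ∫⁻ x in s, gaussianPDF 0 1 x
      ≤ ∫⁻ _ in s, ENNReal.ofReal (√(2 * Real.pi))⁻¹ := by
        refine lintegral_mono fun x ↦ ENNReal.ofReal_le_ofReal ?_
        simp only [gaussianPDFReal, NNReal.coe_one, mul_one]
        exact mul_le_of_le_one_right (by positivity)
          (Real.exp_le_one_iff.2 (by rw [neg_div]; exact neg_nonpos.2 (by positivity)))
    _ = _ := by simp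

lemma gaussianReal_zero_one_le_volume (s : Set ℝ) : gaussianReal 0 1 s ≤ volume s := by
  refine (gaussianReal_zero_one_le s).trans (mul_le_of_le_one_left (by positivity) ?_)
  rw [ENNReal.ofReal_le_one]
  exact inv_le_one_of_one_le₀ (Real.one_le_sqrt.2 (by linarith [Real.pi_gt_three]))

section InnerProduct

variable {E : Type*} [NormedAddCommGroup E] [InnerProductSpace ℝ E] [FiniteDimensional ℝ E]
  [MeasurableSpace E] [BorelSpace E]

lemma map_inner_stdGaussian {u : E} (hu : ‖u‖ = 1) :
    (ProbabilityTheory.stdGaussian E).map (fun x ↦ inner ℝ u x) = gaussianReal 0 1 := by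
  have h : HasGaussianLaw (innerSL ℝ u) (ProbabilityTheory.stdGaussian E) :=
    IsGaussian.hasGaussianLaw_id.map (innerSL ℝ u)
  have := h.map_eq_gaussianReal
  rw [integral_strongDual_stdGaussian, variance_dual_stdGaussian, innerSL_apply_norm, hu] at this
  simpa using! this

/-- The coordinates of a standard Gaussian vector along two orthonormal directions are
independent standard Gaussians. -/
lemma map_inner_prodMk_inner_stdGaussian {u w : E} (hu : ‖u‖ = 1) (hw : ‖w‖ = 1)
    (huw : inner ℝ u w = 0) :
    (ProbabilityTheory.stdGaussian E).map (fun x ↦ (inner ℝ u x, inner ℝ w x)) =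
      (gaussianReal 0 1).prod (gaussianReal 0 1) := by
  have hlaw : HasGaussianLaw (fun x : E ↦ (inner ℝ u x, inner ℝ w x))
      (ProbabilityTheory.stdGaussian E) :=
    IsGaussian.hasGaussianLaw_id.map ((innerSL ℝ u).prod (innerSL ℝ w))
  have hcov : cov[fun x : E ↦ inner ℝ u x, fun x ↦ inner ℝ w x;
      ProbabilityTheory.stdGaussian E] = 0 := by
    rw [← covarianceBilin_apply_eq_cov IsGaussian.memLp_two_id, covarianceBilin_stdGaussian]
    exact huw
  have hind := hlaw.indepFun_of_covariance_eq_zero hcov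
  rw [indepFun_iff_map_prod_eq_prod_map_map (by fun_prop) (by fun_prop)] at hind
  rw [hind, map_inner_stdGaussian hu, map_inner_stdGaussian hw]

end InnerProduct

/-- The standard Gaussian measure of a parallelogram in the plane. -/
lemma gaussianReal_prod_parallelogram_le (ρ s ε a b : ℝ) (hs : 0 < s) (hε : 0 < ε) :
    (gaussianReal 0 1).prod (gaussianReal 0 1)
        {p : ℝ × ℝ | p.1 ∈ Set.Icc a (a + ε) ∧ ρ * p.1 + s * p.2 ∈ Set.Icc b (b + ε)} ≤
      ENNReal.ofReal (ε ^ 2 / (√(2 * Real.pi) * s)) := by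
  have hmeas : MeasurableSet
      {p : ℝ × ℝ | p.1 ∈ Set.Icc a (a + ε) ∧ ρ * p.1 + s * p.2 ∈ Set.Icc b (b + ε)} :=
    (measurableSet_Icc.preimage measurable_fst).inter
      (measurableSet_Icc.preimage (by fun_prop : Measurable fun p : ℝ × ℝ ↦ ρ * p.1 + s * p.2))
  set K : ENNReal := ENNReal.ofReal ((√(2 * Real.pi))⁻¹ * (ε / s)) with hK
  have hslice (x : ℝ) :
      gaussianReal 0 1 {y : ℝ | ρ * x + s * y ∈ Set.Icc b (b + ε)} ≤ K := by
    have hsub : {y : ℝ | ρ * x + s * y ∈ Set.Icc b (b + ε)} ⊆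
        Set.Icc ((b - ρ * x) / s) ((b + ε - ρ * x) / s) := by
      rintro y ⟨h₁, h₂⟩
      rw [Set.mem_Icc, div_le_iff₀ hs, le_div_iff₀ hs]
      constructor <;> linarith
    refine (measure_mono hsub).trans ((gaussianReal_zero_one_le _).trans_eq ?_)
    rw [Real.volume_Icc, hK, ENNReal.ofReal_mul (by positivity)]
    congr 2
    ring
  calc _ = ∫⁻ x, gaussianReal 0 1
          {y | x ∈ Set.Icc a (a + ε) ∧ ρ * x + s * y ∈ Set.Icc b (b + ε)} ∂gaussianReal 0 1 :=
        Measure.prod_apply hmeas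
    _ ≤ ∫⁻ x, (Set.Icc a (a + ε)).indicator (fun _ ↦ K) x ∂gaussianReal 0 1 := by
        refine lintegral_mono fun x ↦ ?_
        by_cases hx : x ∈ Set.Icc a (a + ε)
        · simpa only [hx, true_and, Set.indicator_of_mem] using hslice x
        · simp only [hx, false_and, Set.ofPred_false, measure_empty, zero_le]
    _ = K * gaussianReal 0 1 (Set.Icc a (a + ε)) := lintegral_indicator_const measurableSet_Icc K
    _ ≤ K * ENNReal.ofReal ε := by
        gcongr
        refine (gaussianReal_zero_one_le_volume _).trans_eq ?_
        rw [Real.volume_Icc, add_sub_cancel_left]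
    _ = _ := by
        rw [hK, ← ENNReal.ofReal_mul (by positivity)]
        congr 1
        field_simp

/-- Lemma: for unit vectors `u, v ∈ ℝ^d`, `ε > 0` and `c_S, c_T ∈ ℝ`, the standard Gaussian
measure of the intersection of the slabs `{x : c_S ≤ ⟨x,u⟩ ≤ c_S + ε}` and
`{x : c_T ≤ ⟨x,v⟩ ≤ c_T + ε}` is at most `ε² / √(2π (1 - ⟨u,v⟩²))` (with the convention that
the right-hand side is `∞` when `u` and `v` are parallel, expressed via `ℝ≥0∞`-division). -/
theorem stmt9 (d : ℕ) (u v : EuclideanSpace ℝ (Fin d)) (hu : ‖u‖ = 1) (hv : ‖v‖ = 1)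
    (ε : ℝ) (hε : 0 < ε) (cS cT : ℝ) :
    stdGaussian d
        ({x : EuclideanSpace ℝ (Fin d) | cS ≤ (inner ℝ x u : ℝ) ∧ (inner ℝ x u : ℝ) ≤ cS + ε} ∩
          {x : EuclideanSpace ℝ (Fin d) | cT ≤ (inner ℝ x v : ℝ) ∧ (inner ℝ x v : ℝ) ≤ cT + ε}) ≤
      ENNReal.ofReal (ε ^ 2) /
        ENNReal.ofReal (Real.sqrt (2 * Real.pi * (1 - (inner ℝ u v : ℝ) ^ 2))) := by
  set ρ : ℝ := inner ℝ u v with hρ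
  rcases le_or_gt (1 - ρ ^ 2) 0 with hpar | hpos
  · have hnonpos : 2 * Real.pi * (1 - ρ ^ 2) ≤ 0 :=
      mul_nonpos_of_nonneg_of_nonpos (by positivity) hpar
    rw [Real.sqrt_eq_zero_of_nonpos hnonpos, ENNReal.ofReal_zero,
      ENNReal.div_zero (ENNReal.ofReal_pos.2 (by positivity)).ne']
    exact le_top
  set s : ℝ := √(1 - ρ ^ 2) with hs_def
  have hs : 0 < s := Real.sqrt_pos.2 hpos
  have hs_sq : s ^ 2 = 1 - ρ ^ 2 := Real.sq_sqrt hpos.le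
  set w : EuclideanSpace ℝ (Fin d) := s⁻¹ • (v - ρ • u) with hw_def
  have hv_eq : v = ρ • u + s • w := by
    rw [hw_def, smul_inv_smul₀ hs.ne', add_sub_cancel]
  have huw : inner ℝ u w = 0 := by
    rw [hw_def, inner_smul_right, inner_sub_right, inner_smul_right, real_inner_self_eq_norm_sq,
      hu, ← hρ]
    ring
  have hw : ‖w‖ = 1 := by
    have hsq : ‖v - ρ • u‖ ^ 2 = s ^ 2 := by
      rw [norm_sub_sq_real, inner_smul_right, real_inner_comm, ← hρ, norm_smul, hu, hv, hs_sq,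
        Real.norm_eq_abs, mul_one, sq_abs]
      ring
    rw [hw_def, norm_smul, (sq_eq_sq₀ (norm_nonneg _) hs.le).1 hsq, norm_inv, Real.norm_eq_abs,
      abs_of_pos hs, inv_mul_cancel₀ hs.ne']
  set P : Set (ℝ × ℝ) :=
    {p | p.1 ∈ Set.Icc cS (cS + ε) ∧ ρ * p.1 + s * p.2 ∈ Set.Icc cT (cT + ε)} with hP
  have hpre : ({x : EuclideanSpace ℝ (Fin d) | cS ≤ inner ℝ x u ∧ inner ℝ x u ≤ cS + ε} ∩
      {x | cT ≤ inner ℝ x v ∧ inner ℝ x v ≤ cT + ε}) =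
      (fun x ↦ (inner ℝ u x, inner ℝ w x)) ⁻¹' P := by
    ext x
    have hxv : inner ℝ x v = ρ * inner ℝ u x + s * inner ℝ w x := by
      conv_lhs => rw [hv_eq]
      rw [inner_add_right, inner_smul_right, inner_smul_right, real_inner_comm u x,
        real_inner_comm w x]
    simp only [hP, Set.mem_inter_iff, Set.mem_ofPred_eq, Set.mem_preimage, Set.mem_Icc, hxv,
      real_inner_comm u x]
  rw [hpre, stdGaussian_eq_probabilityTheory_stdGaussian]
  refine (Measure.le_map_apply (by fun_prop) P).trans ?_
  rw [map_inner_prodMk_inner_stdGaussian hu hw huw, Real.sqrt_mul (by positivity), ← hs_def,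
    ← ENNReal.ofReal_div_of_pos (by positivity)]
  exact gaussianReal_prod_parallelogram_le ρ s ε cS cT hs hε
end
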